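/- Let n ≥ 2 and 2 ≤ k < n, and let s be any stable wiring for the uniform (n,k)-BDNF game. Then for any two nodes u and v, c_v(s) ≤ c_u(s) + n + n·⌊log_k n⌋. -/

import Mathlib

namespace BDNF

variable {V : Type} [DecidableEq V]

/-- `connIn s m v u` : there is a directed path with at most `m` edges from `v`
to `u` in the directed graph defined by the wiring `s`. -/
def connIn (s : V → Finset V) : ℕ → V → V → Prop
  | 0, v, u => v = u
  | m + 1, v, u => v = u ∨ ∃ w ∈ s v, connIn s m w u

/-- Directed hop distance from `v` to `u`, with disconnection penalty `M`. -/
noncomputable def distW (s : V → Finset V) (M : ℕ) (v u : V) : ℕ := by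
  classical exact if h : ∃ m, connIn s m v u then Nat.find h else M

/-- Cost of node `v` in the uniform game: the sum of its distances to all
other nodes. -/
noncomputable def cost [Fintype V] (s : V → Finset V) (M : ℕ) (v : V) : ℕ :=
  ∑ u ∈ Finset.univ.filter (fun u => u ≠ v), distW s M v u

/-- `s` is a wiring with out-degree bound `k`: every node links to at most `k`
other nodes. -/
def IsWiring (k : ℕ) (s : V → Finset V) : Prop :=
  ∀ v, v ∉ s v ∧ (s v).card ≤ k

/-- `s` is stable (a pure Nash equilibrium) for the uniform game: no node can
strictly decrease its cost by rewiring its own out-links. -/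
def Stable [Fintype V] (k M : ℕ) (s : V → Finset V) : Prop :=
  ∀ (v : V) (t : Finset V), v ∉ t → t.card ≤ k →
    cost s M v ≤ cost (Function.update s v t) M v

set_option linter.unusedSectionVars false

theorem connIn_self (s : V → Finset V) (m : ℕ) (v : V) : connIn s m v v := by
  cases m with
  | zero => rfl
  | succ m => exact Or.inl rfl

theorem connIn.mono {s : V → Finset V} {a b : ℕ} {x y : V}
    (h : connIn s a x y) (hab : a ≤ b) : connIn s b x y := by
  induction a generalizing b x with
  | zero => cases h; exact connIn_self s b _
  | succ a ih =>
    obtain ⟨b, rfl⟩ := Nat.exists_eq_add_one.2 (Nat.zero_lt_of_lt hab)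
    rcases h with rfl | ⟨w, hw, h⟩
    · exact connIn_self s _ _
    · exact Or.inr ⟨w, hw, ih h (Nat.le_of_succ_le_succ hab)⟩

theorem connIn.trans {s : V → Finset V} {a b : ℕ} {x y z : V}
    (h₁ : connIn s a x y) (h₂ : connIn s b y z) : connIn s (b + a) x z := by
  induction a generalizing x with
  | zero => cases h₁; exact h₂
  | succ a ih =>
    rcases h₁ with rfl | ⟨w, hw, h⟩
    · exact h₂.mono (Nat.le_add_right _ _)
    · exact Or.inr ⟨w, hw, ih h⟩

theorem connIn_one {s : V → Finset V} {x y : V} (h : y ∈ s x) : connIn s 1 x y :=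
  Or.inr ⟨y, h, rfl⟩

/-- A walk splits off its last edge. -/
theorem connIn.exists_last {s : V → Finset V} {m : ℕ} {x y : V}
    (h : connIn s (m + 1) x y) : x = y ∨ ∃ q, connIn s m x q ∧ y ∈ s q := by
  induction m generalizing x with
  | zero =>
    rcases h with h | ⟨w, hw, rfl⟩
    · exact Or.inl h
    · exact Or.inr ⟨x, rfl, hw⟩
  | succ m ih =>
    rcases h with h | ⟨w, hw, h⟩
    · exact Or.inl h
    · rcases ih h with rfl | ⟨q, hq, hy⟩
      · exact Or.inr ⟨x, connIn_self s _ _, hw⟩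
      · exact Or.inr ⟨q, Or.inr ⟨w, hw, hq⟩, hy⟩

/-- A node at distance exactly `m` from `u` witnesses at least `m + 1` nodes within distance `m`
of `u`. -/
theorem exists_finset_card_of_minimal {s : V → Finset V} {u : V} (m : ℕ) (v : V)
    (h : connIn s m v u) (hmin : ∀ j < m, ¬ connIn s j v u) :
    ∃ S : Finset V, S.card = m + 1 ∧ ∀ z ∈ S, connIn s m z u := by
  induction m generalizing v with
  | zero => exact ⟨{v}, rfl, by simpa using h⟩
  | succ m ih =>
    rcases h with rfl | ⟨w, hw, h'⟩
    · exact absurd (connIn_self s 0 v) (hmin 0 m.succ_pos)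
    · obtain ⟨S, hS, hSu⟩ := ih w h' fun j hj hc =>
        hmin (j + 1) (by omega) (Or.inr ⟨w, hw, hc⟩)
      refine ⟨insert v S, ?_, ?_⟩
      · rw [Finset.card_insert_of_notMem fun hv => hmin m m.lt_succ_self (hSu v hv), hS]
      · intro z hz
        rcases Finset.mem_insert.1 hz with rfl | hz
        · exact Or.inr ⟨w, hw, h'⟩
        · exact (hSu z hz).mono m.le_succ

theorem distW_le {s : V → Finset V} {M m : ℕ} {v u : V} (h : connIn s m v u) :
    distW s M v u ≤ m := by
  classical
  have hex : ∃ m, connIn s m v u := ⟨m, h⟩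
  rw [distW, dif_pos hex]
  exact Nat.find_min' hex h

theorem connIn_distW {s : V → Finset V} (M : ℕ) {v u : V} (hex : ∃ m, connIn s m v u) :
    connIn s (distW s M v u) v u := by
  classical
  rw [distW, dif_pos hex]
  exact Nat.find_spec hex

theorem distW_of_not_connIn {s : V → Finset V} (M : ℕ) {v u : V}
    (hex : ¬ ∃ m, connIn s m v u) : distW s M v u = M := by
  rw [distW, dif_neg hex]

theorem distW_self (s : V → Finset V) (M : ℕ) (v : V) : distW s M v v = 0 :=
  Nat.le_zero.1 (distW_le (connIn_self s 0 v))

theorem distW_le_penalty [Fintype V] (s : V → Finset V) {M : ℕ} (hM : Fintype.card V ≤ M)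
    (v u : V) : distW s M v u ≤ M := by
  by_cases hex : ∃ m, connIn s m v u
  · obtain ⟨S, hS, -⟩ := exists_finset_card_of_minimal (distW s M v u) v (connIn_distW M hex)
      fun j hj hc => absurd (distW_le (M := M) hc) (by omega)
    have := S.card_le_univ
    omega
  · exact (distW_of_not_connIn M hex).le

theorem cost_eq_sum [Fintype V] (s : V → Finset V) (M : ℕ) (v : V) :
    cost s M v = ∑ u, distW s M v u := by
  rw [cost, Finset.sum_filter]
  refine Finset.sum_congr rfl fun u _ => ?_
  split_ifs with h
  · rfl
  · rw [not_not.1 h, distW_self]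

/-- If everything within reach of `b` under `s` is reached from `a` under `s'` with delay at most
`c`, then the costs differ by at most `c` per node. -/
theorem cost_le_of_connIn [Fintype V] {s s' : V → Finset V} {M c : ℕ} {a b : V}
    (hM : Fintype.card V ≤ M) (h : ∀ x m, connIn s m b x → connIn s' (m + c) a x) :
    cost s' M a ≤ cost s M b + Fintype.card V * c := by
  have key : ∀ x, distW s' M a x ≤ distW s M b x + c := by
    intro x
    by_cases hex : ∃ m, connIn s m b x
    · exact distW_le (h x _ (connIn_distW M hex))
    · rw [distW_of_not_connIn M hex]
      exact (distW_le_penalty s' hM a x).trans (Nat.le_add_right _ _)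
  rw [cost_eq_sum, cost_eq_sum]
  calc ∑ x, distW s' M a x ≤ ∑ x, (distW s M b x + c) := Finset.sum_le_sum fun x _ => key x
    _ = _ := by simp [Finset.sum_add_distrib]

/-- Every node has a predecessor on a shortest path from `u`, if it is reachable from `u` and
different from `u`. -/
theorem exists_parent (s : V → Finset V) (u x : V) :
    ∃ q, ∀ m, connIn s m u x → x ≠ u → x ∈ s q ∧ ∃ j < m, connIn s j u q := by
  classical
  by_cases hex : ∃ m, connIn s m u x
  · by_cases hxu : x = u
    · exact ⟨u, fun _ _ h => absurd hxu h⟩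
    have hspec := Nat.find_spec hex
    cases hm : Nat.find hex with
    | zero =>
      rw [hm] at hspec
      exact absurd hspec.symm hxu
    | succ m =>
      rw [hm] at hspec
      rcases hspec.exists_last with h | ⟨q, hq, hx⟩
      · exact absurd h.symm hxu
      · refine ⟨q, fun l hl _ => ⟨hx, m, ?_, hq⟩⟩
        have := Nat.find_min' hex hl
        omega
  · exact ⟨u, fun m hm => absurd ⟨m, hm⟩ hex⟩

/-- In a stable wiring, a node `w` with fewer than `k` children in a shortest-path tree of `u`
costs at most `|V|` more than `u`: it could link to `u` while keeping its tree edges. -/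
theorem cost_le_of_card_children_lt [Fintype V] {k M : ℕ} {s : V → Finset V}
    (hM : Fintype.card V ≤ M) (hw : IsWiring k s) (hs : Stable k M s) {u w : V} {p : V → V}
    (hp : ∀ x m, connIn s m u x → x ≠ u → x ∈ s (p x) ∧ ∃ j < m, connIn s j u (p x))
    (hlt : ((s w).filter fun y => p y = w).card < k) :
    cost s M w ≤ cost s M u + Fintype.card V := by
  by_cases hwu : w = u
  · rw [hwu]; omega
  set t := insert u ((s w).filter fun y => p y = w) with ht
  have hwt : w ∉ t := by
    simp [ht, hwu, (hw w).1]
  refine (hs w t hwt ((Finset.card_insert_le _ _).trans hlt)).trans ?_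
  have hpath : ∀ m x, connIn s m u x → connIn (Function.update s w t) m u x := by
    intro m
    induction m using Nat.strong_induction_on with
    | _ m ih =>
      intro x hx
      by_cases hxu : x = u
      · rw [hxu]; exact connIn_self _ _ _
      obtain ⟨hxp, j, hj, hc⟩ := hp x m hx hxu
      have hedge : x ∈ Function.update s w t (p x) := by
        by_cases hpw : p x = w
        · rw [hpw] at hxp
          rw [hpw, Function.update_self, ht]
          exact Finset.mem_insert_of_mem (Finset.mem_filter.2 ⟨hxp, hpw⟩)
        · rwa [Function.update_of_ne hpw]
      exact ((ih j hj _ hc).trans (connIn_one hedge)).mono (by omega)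
  have huw : u ∈ Function.update s w t w := by simp [ht]
  simpa using cost_le_of_connIn (c := 1) hM
    fun x m hx => (connIn_one huw).trans (hpath m x hx)

/-- Within distance `D` of any node there is one with fewer than `k` children with respect to `p`,
as soon as `k ^ (D + 1)` exceeds the number of nodes. -/
theorem exists_card_children_lt [Fintype V] {k D : ℕ} (s : V → Finset V) (p : V → V) (v : V)
    (hD : Fintype.card V < k ^ (D + 1)) :
    ∃ w, connIn s D v w ∧ ((s w).filter fun y => p y = w).card < k := by
  by_contra! hcon
  have hlevel : ∀ i ≤ D + 1, ∃ L : Finset V, k ^ i ≤ L.card ∧ ∀ z ∈ L, connIn s i v z := by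
    intro i
    induction i with
    | zero => exact fun _ => ⟨{v}, by simp, by simp [connIn]⟩
    | succ i ih =>
      intro hi
      obtain ⟨L, hL, hconn⟩ := ih (by omega)
      refine ⟨L.biUnion fun w => (s w).filter fun y => p y = w, ?_, ?_⟩
      · rw [Finset.card_biUnion]
        · calc k ^ (i + 1) = k ^ i * k := pow_succ k i
            _ ≤ L.card * k := Nat.mul_le_mul_right k hL
            _ = ∑ _w ∈ L, k := by simp
            _ ≤ _ := Finset.sum_le_sum fun w hw => hcon w ((hconn w hw).mono (by omega))
        · intro a _ b _ hab
          refine Finset.disjoint_left.2 fun y hya hyb => hab ?_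
          exact (Finset.mem_filter.1 hya).2.symm.trans (Finset.mem_filter.1 hyb).2
      · intro z hz
        obtain ⟨w, hw, hz⟩ := Finset.mem_biUnion.1 hz
        exact ((hconn w hw).trans (connIn_one (Finset.mem_filter.1 hz).1)).mono (by omega)
  obtain ⟨L, hL, -⟩ := hlevel (D + 1) le_rfl
  have := L.card_le_univ
  omega

/-- In any stable wiring for the uniform `(n,k)`-BDNF game with `n ≥ 2` and
`2 ≤ k < n`, the cost of any node is at most `n + n⌊log_k n⌋` more than the
cost of any other node. -/
theorem stmt_5 :
    ∀ n : ℕ, 2 ≤ n → ∀ k : ℕ, 2 ≤ k → k < n → ∀ M : ℕ, n ^ 2 < M →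
      ∀ s : Fin n → Finset (Fin n), IsWiring k s → Stable k M s →
        ∀ u v : Fin n, cost s M v ≤ cost s M u + n + n * Nat.log k n := by
  intro n hn k hk hkn M hM s hw hs u v
  have hcard : Fintype.card (Fin n) = n := Fintype.card_fin n
  have hcM : Fintype.card (Fin n) ≤ M := by rw [hcard]; nlinarith
  choose p hp using exists_parent s u
  obtain ⟨w, hvw, hlt⟩ := exists_card_children_lt (k := k) (D := Nat.log k n) s p v
    (by rw [hcard]; exact Nat.lt_pow_succ_log_self hk n)
  have h₁ := cost_le_of_card_children_lt hcM hw hs hp hlt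
  have h₂ : cost s M v ≤ cost s M w + _ :=
    cost_le_of_connIn hcM fun x m hx => hvw.trans hx
  rw [hcard] at h₁ h₂
  omega

end BDNF
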